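/- arXiv:2402.04375 — 2 statements merged into one kernel-verified Lean document; each statement's English description precedes it below -/
import Mathlib

section
/- There exists an absolute constant C > 0 such that the following holds. Let m, n ≥ 1 and d ≥ 2 be integers with d ≤ m+1, let ν ≥ 0, and let τ > 0 satisfy τ·√m ≥ 1. Let D_r and D_s be datasets of size n over m+1 attributes, and let w_r be a minimizer of the logistic empirical risk L̂(·,D_r) over the ball {w ∈ ℝ^m : ‖w‖₂ ≤ τ} and w_s a minimizer of L̂(·,D_s) over the same ball. If ‖M_q(D_r) − M_q(D_s)‖₁ ≤ ν for every q ∈ Q^m_{≤d}, then |L̂(w_s,D_r) − L̂(w_r,D_r)| ≤ C·( τ²·m/(d−1) + (1/n)·τ·√m·(2m·max{1,τ})^{d−1}·ν ). (With τ = 1/√m the first term is C/(d−1).) -/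
noncomputable section
open Finset MeasureTheory ProbabilityTheory Real

def ValidDomains (m : ℕ) (Ω : Fin (m+1) → Finset ℝ) : Prop :=
  (∀ j, (Ω j : Set ℝ) ⊆ Set.Icc (-1 : ℝ) 1) ∧ Ω (Fin.last m) = ({-1, 1} : Finset ℝ)

def ValidDataset {m n : ℕ} (Ω : Fin (m+1) → Finset ℝ) (D : Fin n → Fin (m+1) → ℝ) : Prop :=
  ∀ i j, D i j ∈ Ω j

def marginal {m n : ℕ} (D : Fin n → Fin (m+1) → ℝ) (q : Finset (Fin (m+1)))
    (t : ∀ j ∈ q, ℝ) : ℝ :=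
  Nat.card {i : Fin n // ∀ j (h : j ∈ q), D i j = t j h}

def margL1 {m n : ℕ} (Ω : Fin (m+1) → Finset ℝ) (Dr Ds : Fin n → Fin (m+1) → ℝ)
    (q : Finset (Fin (m+1))) : ℝ :=
  ∑ t ∈ q.pi Ω, |marginal Dr q t - marginal Ds q t|

def margin {m : ℕ} (w : EuclideanSpace ℝ (Fin m)) (v : Fin (m+1) → ℝ) : ℝ :=
  (∑ j : Fin m, w j * v j.castSucc) * v (Fin.last m)

def risk {m n : ℕ} (φ : ℝ → ℝ) (w : EuclideanSpace ℝ (Fin m))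
    (D : Fin n → Fin (m+1) → ℝ) : ℝ :=
  (1 / n) * ∑ i, φ (margin w (D i))

/-- The logistic loss `φ̂(z) = ln(1+e^{-z})`. -/
def logisticLoss (z : ℝ) : ℝ := Real.log (1 + Real.exp (-z))

/-- The discrepancy between two datasets on a query depending only on the attributes in `q` is
controlled by the `ℓ¹` distance between the marginals on `q`. -/
theorem abs_sum_sub_sum_le_margL1 {m n : ℕ} {Ω : Fin (m+1) → Finset ℝ}
    {Dr Ds : Fin n → Fin (m+1) → ℝ} (hDr : ValidDataset Ω Dr) (hDs : ValidDataset Ω Ds)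
    (hn : 0 < n) (q : Finset (Fin (m+1))) (h : (Fin (m+1) → ℝ) → ℝ)
    (hq : ∀ v v' : Fin (m+1) → ℝ, (∀ j ∈ q, v j = v' j) → h v = h v') {B : ℝ}
    (hB : ∀ v : Fin (m+1) → ℝ, (∀ j, v j ∈ Ω j) → |h v| ≤ B) :
    |∑ i, h (Dr i) - ∑ i, h (Ds i)| ≤ B * margL1 Ω Dr Ds q := by
  classical
  let H : (∀ j ∈ q, ℝ) → ℝ := fun t =>
    h (fun j => if hj : j ∈ q then t j hj else Dr ⟨0, hn⟩ j)
  have expand : ∀ D : Fin n → Fin (m+1) → ℝ, ValidDataset Ω D →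
      ∑ i, h (D i) = ∑ t ∈ q.pi Ω, H t * marginal D q t := by
    intro D hD
    have hmarg : ∀ t : (∀ j ∈ q, ℝ), marginal D q t =
        ∑ i, if (fun j (_ : j ∈ q) => D i j) = t then (1 : ℝ) else 0 := by
      intro t
      rw [marginal, Nat.card_eq_fintype_card, Fintype.card_subtype, Finset.sum_boole]
      congr 2
      ext i
      simp [funext_iff]
    simp_rw [hmarg, Finset.mul_sum]
    rw [Finset.sum_comm]
    refine Finset.sum_congr rfl fun i _ => ?_
    simp_rw [mul_ite, mul_one, mul_zero]
    rw [Finset.sum_ite_eq, if_pos (Finset.mem_pi.mpr fun j _ => hD i j)]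
    apply hq
    intro j hj
    simp [hj]
  rw [expand Dr hDr, expand Ds hDs, ← Finset.sum_sub_distrib, margL1, Finset.mul_sum]
  refine (Finset.abs_sum_le_sum_abs _ _).trans (Finset.sum_le_sum fun t ht => ?_)
  rw [← mul_sub, abs_mul]
  refine mul_le_mul_of_nonneg_right (hB _ fun j => ?_) (abs_nonneg _)
  by_cases hj : j ∈ q
  · simpa [hj] using Finset.mem_pi.mp ht j hj
  · simpa [hj] using hDr ⟨0, hn⟩ j

/-- Each affine factor `1 + ε * ⟨c, x⟩ * y` with `‖c‖₁ ≤ 1` and `|ε| ≤ 1` uses up one more attribute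
and at most doubles the discrepancy. -/
theorem abs_sum_sub_sum_affine_prod_le {m n d : ℕ} {Ω : Fin (m+1) → Finset ℝ}
    (hΩ : ValidDomains m Ω) {Dr Ds : Fin n → Fin (m+1) → ℝ}
    (hDr : ValidDataset Ω Dr) (hDs : ValidDataset Ω Ds) (hn : 0 < n) {ν : ℝ} (hν : 0 ≤ ν)
    (hmarg : ∀ q : Finset (Fin (m+1)), q.Nonempty → q.card ≤ d → margL1 Ω Dr Ds q ≤ ν)
    {c : Fin m → ℝ} (hc : ∑ j, |c j| ≤ 1) (L : List ℝ) (hL : ∀ ε ∈ L, |ε| ≤ 1)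
    (q : Finset (Fin (m+1))) (hlast : Fin.last m ∈ q) (hcard : q.card + L.length ≤ d)
    (h : (Fin (m+1) → ℝ) → ℝ)
    (hq : ∀ v v' : Fin (m+1) → ℝ, (∀ j ∈ q, v j = v' j) → h v = h v')
    (hB : ∀ v : Fin (m+1) → ℝ, (∀ j, v j ∈ Ω j) → |h v| ≤ 1) :
    |∑ i, h (Dr i) *
        (L.map fun ε => 1 + ε * ∑ j, c j * (Dr i j.castSucc * Dr i (Fin.last m))).prod -
      ∑ i, h (Ds i) *
        (L.map fun ε => 1 + ε * ∑ j, c j * (Ds i j.castSucc * Ds i (Fin.last m))).prod| ≤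
      2 ^ L.length * ν := by
  induction L generalizing q h with
  | nil =>
    simp only [List.map_nil, List.prod_nil, mul_one, List.length_nil, pow_zero]
    refine (abs_sum_sub_sum_le_margL1 hDr hDs hn q h hq hB).trans ?_
    rw [one_mul, one_mul]
    exact hmarg q ⟨_, hlast⟩ (by simpa using hcard)
  | cons ε L ih =>
    have hε : |ε| ≤ 1 := hL ε (by simp)
    have hL' : ∀ e ∈ L, |e| ≤ 1 := fun e he => hL e (by simp [he])
    rw [List.length_cons] at hcard
    have h0 := ih hL' q hlast (by omega) h hq hB
    have hj : ∀ j : Fin m, _ := fun j =>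
      ih hL' (insert j.castSucc q) (Finset.mem_insert_of_mem hlast)
        (by have := Finset.card_insert_le j.castSucc q; omega)
        (fun v => h v * (v j.castSucc * v (Fin.last m)))
        (by
          intro v v' hvv
          rw [hq v v' fun i hi => hvv i (Finset.mem_insert_of_mem hi),
            hvv _ (Finset.mem_insert_self _ _), hvv _ (Finset.mem_insert_of_mem hlast)])
        (by
          intro v hv
          have habs : ∀ i, |v i| ≤ 1 := fun i => abs_le.mpr (hΩ.1 i (hv i))
          rw [abs_mul, abs_mul]
          exact mul_le_one₀ (hB v hv) (by positivity)
            (mul_le_one₀ (habs _) (abs_nonneg _) (habs _)))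
    have expand : ∀ D : Fin n → Fin (m+1) → ℝ,
        ∑ i, h (D i) * ((ε :: L).map fun ε =>
          1 + ε * ∑ j, c j * (D i j.castSucc * D i (Fin.last m))).prod =
        ∑ i, h (D i) *
          (L.map fun ε => 1 + ε * ∑ j, c j * (D i j.castSucc * D i (Fin.last m))).prod +
        ∑ j, ε * c j * ∑ i, h (D i) * (D i j.castSucc * D i (Fin.last m)) *
          (L.map fun ε => 1 + ε * ∑ j, c j * (D i j.castSucc * D i (Fin.last m))).prod := by
      intro D
      simp_rw [Finset.mul_sum (Finset.univ : Finset (Fin n))]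
      rw [Finset.sum_comm, ← Finset.sum_add_distrib]
      refine Finset.sum_congr rfl fun i _ => ?_
      rw [List.map_cons, List.prod_cons]
      generalize (L.map fun ε =>
        1 + ε * ∑ j, c j * (D i j.castSucc * D i (Fin.last m))).prod = P
      rw [add_mul, mul_add, one_mul, Finset.mul_sum, Finset.sum_mul, Finset.mul_sum]
      congr 1
      exact Finset.sum_congr rfl fun j _ => by ring
    rw [expand, expand, add_sub_add_comm]
    refine (abs_add_le _ _).trans ?_
    have hsum : |∑ j, ε * c j * (∑ i, h (Dr i) * (Dr i j.castSucc * Dr i (Fin.last m)) *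
          (L.map fun ε => 1 + ε * ∑ j, c j * (Dr i j.castSucc * Dr i (Fin.last m))).prod) -
        ∑ j, ε * c j * (∑ i, h (Ds i) * (Ds i j.castSucc * Ds i (Fin.last m)) *
          (L.map fun ε => 1 + ε * ∑ j, c j * (Ds i j.castSucc * Ds i (Fin.last m))).prod)| ≤
        2 ^ L.length * ν := by
      rw [← Finset.sum_sub_distrib]
      refine (Finset.abs_sum_le_sum_abs _ _).trans ?_
      calc _ ≤ ∑ j, |c j| * (2 ^ L.length * ν) := by
            refine Finset.sum_le_sum fun j _ => ?_
            rw [← mul_sub, abs_mul, abs_mul]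
            refine mul_le_mul ?_ (hj j) (abs_nonneg _) (abs_nonneg _)
            exact mul_le_of_le_one_left (abs_nonneg _) hε
        _ = (∑ j, |c j|) * (2 ^ L.length * ν) := by rw [Finset.sum_mul]
        _ ≤ 2 ^ L.length * ν := mul_le_of_le_one_left (by positivity) hc
    rw [List.length_cons, pow_succ]
    linarith

/-- Convexity of the logistic loss, as a tangent line inequality. -/
theorem logisticLoss_tangent_le (a b : ℝ) :
    -(1 / (1 + Real.exp a)) * (b - a) ≤ logisticLoss b - logisticLoss a := by
  have ha := Real.exp_pos a
  have ha' := Real.exp_pos (-a)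
  have hb' := Real.exp_pos (-b)
  rw [logisticLoss, logisticLoss, ← Real.log_div (by positivity) (by positivity),
    Real.le_log_iff_exp_le (by positivity)]
  have hconv := convexOn_exp.2 (Set.mem_univ (0 : ℝ)) (Set.mem_univ (-(b - a)))
    (show 0 ≤ Real.exp a / (1 + Real.exp a) by positivity)
    (show 0 ≤ 1 / (1 + Real.exp a) by positivity) (by field_simp; ring)
  simp only [smul_eq_mul, mul_zero, zero_add, Real.exp_zero, mul_one] at hconv
  calc Real.exp (-(1 / (1 + Real.exp a)) * (b - a))
      = Real.exp (1 / (1 + Real.exp a) * -(b - a)) := by congr 1; ring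
    _ ≤ _ := hconv
    _ = _ := by
      rw [show -(b - a) = a + -b by ring, Real.exp_add, Real.exp_neg a]
      field_simp
      ring

theorem inv_one_add_exp_sub_mul_le (a b : ℝ) :
    (1 / (1 + Real.exp a) - 1 / (1 + Real.exp b)) * (b - a) ≤ (b - a) ^ 2 := by
  wlog hab : a ≤ b generalizing a b
  · have := this b a (le_of_not_ge hab)
    nlinarith
  have ha := Real.exp_pos a
  have hb := Real.exp_pos b
  have h1 : Real.exp b - Real.exp a ≤ (b - a) * Real.exp b := by
    have h := mul_le_mul_of_nonneg_right (Real.add_one_le_exp (a - b)) hb.le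
    rw [← Real.exp_add, sub_add_cancel] at h
    linarith
  have h2 : 1 / (1 + Real.exp a) - 1 / (1 + Real.exp b) ≤ b - a := by
    rw [div_sub_div _ _ (by positivity) (by positivity), div_le_iff₀ (by positivity)]
    nlinarith [mul_nonneg (sub_nonneg.mpr hab) ha.le,
      mul_nonneg (sub_nonneg.mpr hab) (mul_pos ha hb).le]
  nlinarith

theorem abs_logisticLoss_taylor_le (a b : ℝ) :
    |logisticLoss b - logisticLoss a - -(1 / (1 + Real.exp a)) * (b - a)| ≤ (b - a) ^ 2 := by
  have h1 := logisticLoss_tangent_le a b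
  have h2 := logisticLoss_tangent_le b a
  have h3 := inv_one_add_exp_sub_mul_le a b
  rw [abs_of_nonneg (by linarith)]
  linarith

theorem abs_logisticLoss_le {R z : ℝ} (hR : 1 ≤ R) (hz : |z| ≤ R) :
    |logisticLoss z| ≤ 2 * R := by
  have hz' := abs_le.mp hz
  have hpos := Real.exp_pos (-z)
  have h0 : 0 ≤ logisticLoss z := Real.log_nonneg (by linarith)
  rw [abs_of_nonneg h0, logisticLoss, Real.log_le_iff_le_exp (by positivity)]
  have h1 : Real.exp (-z) ≤ Real.exp R := Real.exp_le_exp.mpr (by linarith)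
  have h2 : 2 ≤ Real.exp R := by linarith [Real.add_one_le_exp R]
  rw [two_mul, Real.exp_add]
  nlinarith

/-- Quantitative Bernstein approximation on `[-R, R]` of a function with a second order Taylor
bound. -/
theorem abs_bernstein_sub_le {k : ℕ} (hk : 0 < k) {f g : ℝ → ℝ}
    (hf : ∀ a b, |f b - f a - g a * (b - a)| ≤ (b - a) ^ 2) {R x : ℝ}
    (hx0 : 0 ≤ x) (hx1 : x ≤ 1) :
    |∑ j ∈ Finset.range (k + 1),
        f (R * (2 * (j / k) - 1)) * (k.choose j * x ^ j * (1 - x) ^ (k - j)) -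
      f (R * (2 * x - 1))| ≤ R ^ 2 / k := by
  have hk0 : (0 : ℝ) < k := by exact_mod_cast hk
  have hsum : ∑ j ∈ Finset.range (k + 1), (k.choose j * x ^ j * (1 - x) ^ (k - j)) = 1 := by
    simpa [bernsteinPolynomial, Polynomial.eval_finsetSum] using
      congrArg (Polynomial.eval x) (bernsteinPolynomial.sum ℝ k)
  have hmean : ∑ j ∈ Finset.range (k + 1),
      (j : ℝ) * (k.choose j * x ^ j * (1 - x) ^ (k - j)) = k * x := by
    simpa [bernsteinPolynomial, Polynomial.eval_finsetSum] using
      congrArg (Polynomial.eval x) (bernsteinPolynomial.sum_smul ℝ k)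
  have hvar : ∑ j ∈ Finset.range (k + 1),
      (k * x - j) ^ 2 * (k.choose j * x ^ j * (1 - x) ^ (k - j)) = k * (x * (1 - x)) := by
    simpa [bernsteinPolynomial, Polynomial.eval_finsetSum, mul_assoc] using
      congrArg (Polynomial.eval x) (bernsteinPolynomial.variance ℝ k)
  set p : ℕ → ℝ := fun j => k.choose j * x ^ j * (1 - x) ^ (k - j) with hp
  have hp0 : ∀ j, 0 ≤ p j := fun j => by
    have : 0 ≤ 1 - x := by linarith
    positivity
  change ∑ j ∈ Finset.range (k + 1), p j = 1 at hsum
  change ∑ j ∈ Finset.range (k + 1), (j : ℝ) * p j = k * x at hmean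
  change ∑ j ∈ Finset.range (k + 1), (k * x - j) ^ 2 * p j = k * (x * (1 - x)) at hvar
  change |∑ j ∈ Finset.range (k + 1), f (R * (2 * (j / k) - 1)) * p j - _| ≤ _
  set a := R * (2 * x - 1) with ha
  have hlin : ∑ j ∈ Finset.range (k + 1), (R * (2 * (j / k) - 1) - a) * p j = 0 := by
    calc _ = 2 * R / k * ∑ j ∈ Finset.range (k + 1), (j : ℝ) * p j -
          2 * R * x * ∑ j ∈ Finset.range (k + 1), p j := by
          rw [Finset.mul_sum, Finset.mul_sum, ← Finset.sum_sub_distrib]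
          refine Finset.sum_congr rfl fun j _ => ?_
          rw [ha]
          ring
      _ = 0 := by
          rw [hmean, hsum]
          field_simp
          ring
  have hrem : ∑ j ∈ Finset.range (k + 1), f (R * (2 * (j / k) - 1)) * p j - f a =
      ∑ j ∈ Finset.range (k + 1), (f (R * (2 * (j / k) - 1)) - f a -
        g a * (R * (2 * (j / k) - 1) - a)) * p j := by
    calc _ = ∑ j ∈ Finset.range (k + 1), f (R * (2 * (j / k) - 1)) * p j -
          f a * ∑ j ∈ Finset.range (k + 1), p j -
          g a * ∑ j ∈ Finset.range (k + 1), (R * (2 * (j / k) - 1) - a) * p j := by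
          rw [hlin, hsum]
          ring
      _ = _ := by
          rw [Finset.mul_sum, Finset.mul_sum, ← Finset.sum_sub_distrib,
            ← Finset.sum_sub_distrib]
          exact Finset.sum_congr rfl fun j _ => by ring
  rw [hrem]
  refine (Finset.abs_sum_le_sum_abs _ _).trans ?_
  calc _ ≤ ∑ j ∈ Finset.range (k + 1), (R * (2 * (j / k) - 1) - a) ^ 2 * p j := by
        refine Finset.sum_le_sum fun j _ => ?_
        rw [abs_mul, abs_of_nonneg (hp0 j)]
        exact mul_le_mul_of_nonneg_right (hf _ _) (hp0 j)
    _ = 4 * R ^ 2 / k ^ 2 * ∑ j ∈ Finset.range (k + 1), (k * x - j) ^ 2 * p j := by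
        rw [Finset.mul_sum]
        refine Finset.sum_congr rfl fun j _ => ?_
        rw [ha]
        field_simp
        ring
    _ = R ^ 2 / k * (4 * (x * (1 - x))) := by
        rw [hvar]
        field_simp
    _ ≤ R ^ 2 / k := mul_le_of_le_one_right (by positivity) (by nlinarith [sq_nonneg (2 * x - 1)])

theorem sum_abs_le_sqrt_mul_norm {m : ℕ} (w : EuclideanSpace ℝ (Fin m)) :
    ∑ j, |w j| ≤ Real.sqrt m * ‖w‖ := by
  rw [EuclideanSpace.norm_eq, ← Real.sqrt_mul (by positivity)]
  apply Real.le_sqrt_of_sq_le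
  simpa using sq_sum_le_card_mul_sum_sq (s := Finset.univ) (f := fun j => |w j|)

theorem abs_risk_sub_risk_le {m n k : ℕ} (hk : 0 < k) (hn : 0 < n) {ν R : ℝ} (hν : 0 ≤ ν)
    (hR : 1 ≤ R) {Ω : Fin (m+1) → Finset ℝ} (hΩ : ValidDomains m Ω)
    {Dr Ds : Fin n → Fin (m+1) → ℝ} (hDr : ValidDataset Ω Dr) (hDs : ValidDataset Ω Ds)
    (hmarg : ∀ q : Finset (Fin (m+1)), q.Nonempty → q.card ≤ k + 1 → margL1 Ω Dr Ds q ≤ ν)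
    (w : EuclideanSpace ℝ (Fin m)) (hw : ∑ j, |w j| ≤ R) :
    |risk logisticLoss w Dr - risk logisticLoss w Ds| ≤
      2 * (R ^ 2 / k) + (1 / (n : ℝ)) * (2 * R * 2 ^ k * ν) := by
  have hR0 : 0 < R := by linarith
  have hk0 : (0 : ℝ) < k := by exact_mod_cast hk
  have hn0 : (0 : ℝ) < n := by exact_mod_cast hn
  let c : Fin m → ℝ := fun j => w j / R
  have hc : ∑ j, |c j| ≤ 1 := by
    simp_rw [c, abs_div, abs_of_pos hR0]
    rw [← Finset.sum_div, div_le_one hR0]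
    exact hw
  let u : (Fin (m+1) → ℝ) → ℝ := fun v => ∑ j, c j * (v j.castSucc * v (Fin.last m))
  have hu : ∀ v, R * u v = margin w v := by
    intro v
    simp only [u, c, margin]
    rw [Finset.mul_sum, Finset.sum_mul]
    exact Finset.sum_congr rfl fun j _ => by field_simp
  have hu1 : ∀ v : Fin (m+1) → ℝ, (∀ j, v j ∈ Ω j) → |u v| ≤ 1 := by
    intro v hv
    have habs : ∀ i, |v i| ≤ 1 := fun i => abs_le.mpr (hΩ.1 i (hv i))
    refine (Finset.abs_sum_le_sum_abs _ _).trans ((Finset.sum_le_sum fun j _ => ?_).trans hc)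
    rw [abs_mul, abs_mul]
    exact mul_le_of_le_one_right (abs_nonneg _) (mul_le_one₀ (habs _) (abs_nonneg _) (habs _))
  let b : ℕ → (Fin (m+1) → ℝ) → ℝ := fun j v =>
    k.choose j * ((1 + u v) / 2) ^ j * (1 - (1 + u v) / 2) ^ (k - j)
  let F : ℕ → ℝ := fun j => logisticLoss (R * (2 * (j / k) - 1))
  have happrox : ∀ v : Fin (m+1) → ℝ, (∀ j, v j ∈ Ω j) →
      |∑ j ∈ Finset.range (k + 1), F j * b j v - logisticLoss (margin w v)| ≤ R ^ 2 / k := by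
    intro v hv
    have h1 := abs_le.mp (hu1 v hv)
    have h2 := abs_bernstein_sub_le hk abs_logisticLoss_taylor_le (R := R)
      (x := (1 + u v) / 2) (by linarith) (by linarith)
    rwa [show R * (2 * ((1 + u v) / 2) - 1) = margin w v by rw [← hu]; ring] at h2
  have hb : ∀ j ∈ Finset.range (k + 1),
      |∑ i, b j (Dr i) - ∑ i, b j (Ds i)| ≤ k.choose j * ν := by
    intro j hj
    have hjk : j ≤ k := by simpa [Nat.lt_succ_iff] using hj
    have h := abs_sum_sub_sum_affine_prod_le (d := k + 1) hΩ hDr hDs hn hν hmarg hc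
      (List.replicate j 1 ++ List.replicate (k - j) (-1))
      (by
        intro ε hε
        rcases List.mem_append.mp hε with h | h <;> rw [List.eq_of_mem_replicate h] <;> simp)
      {Fin.last m} (by simp) (by simp; omega) (fun _ => 1) (fun _ _ _ => rfl) (by simp)
    have hlen : (List.replicate j (1 : ℝ) ++ List.replicate (k - j) (-1)).length = k := by
      simp; omega
    rw [hlen] at h
    simp only [List.map_append, List.map_replicate, List.prod_append, List.prod_replicate,
      one_mul] at h
    have hbv : ∀ v, b j v = k.choose j / 2 ^ k * ((1 + u v) ^ j * (1 + -1 * u v) ^ (k - j)) := by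
      intro v
      have hpow : (2 : ℝ) ^ k = 2 ^ j * 2 ^ (k - j) := by rw [← pow_add]; congr 1; omega
      simp only [b]
      rw [show 1 - (1 + u v) / 2 = (1 + -1 * u v) / 2 by ring, div_pow, div_pow, hpow]
      field_simp
    simp_rw [hbv]
    rw [← Finset.mul_sum, ← Finset.mul_sum, ← mul_sub, abs_mul,
      abs_of_nonneg (by positivity : (0 : ℝ) ≤ k.choose j / 2 ^ k)]
    calc _ ≤ (k.choose j / 2 ^ k : ℝ) * (2 ^ k * ν) :=
          mul_le_mul_of_nonneg_left h (by positivity)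
      _ = _ := by field_simp
  have hF : ∀ j ∈ Finset.range (k + 1), |F j| ≤ 2 * R := by
    intro j hj
    apply abs_logisticLoss_le hR
    have hjk : (j : ℝ) ≤ k := by exact_mod_cast (by simpa [Nat.lt_succ_iff] using hj : j ≤ k)
    have h1 : (j : ℝ) / k ≤ 1 := (div_le_one hk0).mpr hjk
    have h0 : 0 ≤ (j : ℝ) / k := by positivity
    rw [abs_mul, abs_of_pos hR0]
    exact mul_le_of_le_one_right hR0.le (abs_le.mpr ⟨by linarith, by linarith⟩)
  have hpoly : |∑ i, ∑ j ∈ Finset.range (k + 1), F j * b j (Dr i) -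
      ∑ i, ∑ j ∈ Finset.range (k + 1), F j * b j (Ds i)| ≤ 2 * R * 2 ^ k * ν := by
    rw [Finset.sum_comm, Finset.sum_comm (s := (Finset.univ : Finset (Fin n))),
      ← Finset.sum_sub_distrib]
    refine (Finset.abs_sum_le_sum_abs _ _).trans ?_
    calc _ ≤ ∑ j ∈ Finset.range (k + 1), 2 * R * (k.choose j * ν) := by
          refine Finset.sum_le_sum fun j hj => ?_
          rw [← Finset.mul_sum, ← Finset.mul_sum, ← mul_sub, abs_mul]
          exact mul_le_mul (hF j hj) (hb j hj) (abs_nonneg _) (by positivity)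
      _ = 2 * R * ((∑ j ∈ Finset.range (k + 1), k.choose j : ℕ) : ℝ) * ν := by
          rw [← Finset.mul_sum, ← Finset.sum_mul]
          push_cast
          ring
      _ = _ := by
          rw [Nat.sum_range_choose]
          push_cast
          ring
  have hdata : ∀ D : Fin n → Fin (m+1) → ℝ, ValidDataset Ω D →
      |∑ i, ∑ j ∈ Finset.range (k + 1), F j * b j (D i) - ∑ i, logisticLoss (margin w (D i))| ≤
        n * (R ^ 2 / k) := by
    intro D hD
    rw [← Finset.sum_sub_distrib]
    refine (Finset.abs_sum_le_sum_abs _ _).trans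
      ((Finset.sum_le_sum fun i _ => happrox (D i) (hD i)).trans_eq ?_)
    simp
  have hr := abs_le.mp (hdata Dr hDr)
  have hs := abs_le.mp (hdata Ds hDs)
  have hp := abs_le.mp hpoly
  rw [risk, risk, ← mul_sub, abs_mul, abs_of_nonneg (by positivity : (0 : ℝ) ≤ 1 / n)]
  calc _ ≤ (1 / (n : ℝ)) * (2 * (n * (R ^ 2 / k)) + 2 * R * 2 ^ k * ν) := by
        refine mul_le_mul_of_nonneg_left (abs_le.mpr ⟨?_, ?_⟩) (by positivity) <;> linarith
    _ = _ := by field_simp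

/-- excess empirical risk bound for logistic regression trained on
marginal-preserving synthetic data. -/
theorem excess_risk_upper_bound_logistic :
    ∃ C : ℝ, 0 < C ∧
      ∀ (m n d : ℕ), 1 ≤ m → 1 ≤ n → 2 ≤ d → d ≤ m + 1 →
      ∀ (ν τ : ℝ), 0 ≤ ν → 0 < τ → 1 ≤ τ * Real.sqrt m →
      ∀ (Ω : Fin (m+1) → Finset ℝ), ValidDomains m Ω →
      ∀ (Dr Ds : Fin n → Fin (m+1) → ℝ), ValidDataset Ω Dr → ValidDataset Ω Ds →
      ∀ (wr ws : EuclideanSpace ℝ (Fin m)),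
        ‖wr‖ ≤ τ →
        (∀ w : EuclideanSpace ℝ (Fin m), ‖w‖ ≤ τ →
          risk logisticLoss wr Dr ≤ risk logisticLoss w Dr) →
        ‖ws‖ ≤ τ →
        (∀ w : EuclideanSpace ℝ (Fin m), ‖w‖ ≤ τ →
          risk logisticLoss ws Ds ≤ risk logisticLoss w Ds) →
      (∀ q : Finset (Fin (m+1)), q.Nonempty → q.card ≤ d → margL1 Ω Dr Ds q ≤ ν) →
      |risk logisticLoss ws Dr - risk logisticLoss wr Dr| ≤
        C * (τ ^ 2 * (m : ℝ) / ((d : ℝ) - 1) +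
          (1 / (n : ℝ)) * τ * Real.sqrt (m : ℝ) *
            (2 * (m : ℝ) * max 1 τ) ^ (d - 1) * ν) := by
  refine ⟨4, by norm_num, ?_⟩
  intro m n d hm hn hd hdm ν τ hν hτ hR Ω hΩ Dr Ds hDr hDs wr ws hwr hminr hws hmins hmarg
  obtain ⟨k, rfl⟩ : ∃ k, d = k + 1 := ⟨d - 1, by omega⟩
  have hk : 0 < k := by omega
  have hk0 : (0 : ℝ) < k := by exact_mod_cast hk
  have hn0 : (0 : ℝ) < n := by exact_mod_cast hn
  have hm1 : (1 : ℝ) ≤ m := by exact_mod_cast hm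
  have key : ∀ w : EuclideanSpace ℝ (Fin m), ‖w‖ ≤ τ → _ := fun w hw =>
    abs_risk_sub_risk_le hk hn hν hR hΩ hDr hDs hmarg w
      ((sum_abs_le_sqrt_mul_norm w).trans
        ((mul_le_mul_of_nonneg_left hw (Real.sqrt_nonneg _)).trans_eq (mul_comm _ _)))
  have h1 := abs_le.mp (key ws hws)
  have h2 := abs_le.mp (key wr hwr)
  have h3 := hmins wr hwr
  have h4 := hminr ws hws
  rw [abs_of_nonneg (by linarith)]
  have hpow : (2 : ℝ) ^ k ≤ (2 * (m : ℝ) * max 1 τ) ^ k := by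
    apply pow_le_pow_left₀ (by norm_num)
    have : (1 : ℝ) ≤ m * max 1 τ := one_le_mul_of_one_le_of_one_le hm1 (le_max_left _ _)
    linarith
  have hsq : (τ * Real.sqrt m) ^ 2 = τ ^ 2 * m := by
    rw [mul_pow, Real.sq_sqrt (by positivity)]
  have hsecond : (1 / (n : ℝ)) * (2 * (τ * Real.sqrt m) * 2 ^ k * ν) ≤
      2 * ((1 / (n : ℝ)) * τ * Real.sqrt m * (2 * (m : ℝ) * max 1 τ) ^ k * ν) := by
    calc (1 / (n : ℝ)) * (2 * (τ * Real.sqrt m) * 2 ^ k * ν)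
        = 2 * ((1 / (n : ℝ)) * τ * Real.sqrt m * 2 ^ k * ν) := by ring
      _ ≤ _ := by gcongr
  rw [hsq] at h1 h2
  have hcast : (((k + 1 : ℕ) : ℝ) - 1) = k := by push_cast; ring
  rw [hcast, Nat.add_sub_cancel]
  linarith
end
end

section
/- Let m, n ≥ 1 and d ≥ 2 be integers, let K > 0, and let τ > 0 satisfy b := τ·√m ≥ 1. Let φ : ℝ → ℝ be continuous and K-Lipschitz, and let P_{d−1}φ be the degree-(d−1) Bernstein polynomial of φ on the interval [−b, b]. Then for every dataset D of size n over m+1 attributes and every w ∈ ℝ^m with ‖w‖₂ ≤ τ, one has |⟨w,x⟩·y| ≤ b for each record (x,y) of D, and |(1/n)·Σ_{(x,y)∈D} P_{d−1}φ(⟨w,x⟩·y) − L(w,D)| ≤ (5/2)·K·τ·√m/√(d−1). -/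
noncomputable section
open Finset MeasureTheory ProbabilityTheory Real

/-- The degree-`d` Bernstein polynomial of `f` on `[a,b]`. -/
def bernsteinPoly (f : ℝ → ℝ) (a b : ℝ) (d : ℕ) (x : ℝ) : ℝ :=
  ∑ i ∈ Finset.range (d + 1),
    f (a + (i : ℝ) * (b - a) / (d : ℝ)) * (d.choose i : ℝ) *
      ((x - a) / (b - a)) ^ i * (1 - (x - a) / (b - a)) ^ (d - i)

/-- Under the Bernstein weights at `t`, the mean distance of the nodes from `t` is at most
`1 / (2 √N)`. -/
theorem sum_abs_sub_mul_bernstein_le {N : ℕ} (hN : N ≠ 0) (t : unitInterval) :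
    ∑ k : Fin (N + 1), |(t : ℝ) - bernstein.z k| * bernstein N k t ≤ 1 / (2 * √N) := by
  have hN' : (0 : ℝ) < N := by positivity
  have hcs := Finset.sum_mul_sq_le_sq_mul_sq (Finset.univ : Finset (Fin (N + 1)))
    (fun k => |(t : ℝ) - bernstein.z k| * √(bernstein N k t)) (fun k => √(bernstein N k t))
  have hsq : ∀ k : Fin (N + 1), √(bernstein N k t) * √(bernstein N k t) = bernstein N k t :=
    fun k => Real.mul_self_sqrt bernstein_nonneg
  simp only [mul_assoc, hsq, mul_pow, sq_abs] at hcs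
  simp only [pow_two (√(bernstein _ _ _)), hsq, bernstein.variance hN, bernstein.probability,
    mul_one] at hcs
  refine abs_le_of_sq_le_sq' (hcs.trans ?_) (by positivity) |>.2
  rw [div_pow, mul_pow, Real.sq_sqrt hN'.le, div_le_div_iff₀ hN' (by positivity)]
  nlinarith [mul_nonneg hN'.le (sq_nonneg (2 * (t : ℝ) - 1))]

/-- Bernstein approximation of a Lipschitz function, with an explicit rate. -/
theorem abs_bernsteinPoly_sub_le {f : ℝ → ℝ} {C : NNReal} (hf : LipschitzWith C f)
    {a b x : ℝ} (hab : a < b) (hx : x ∈ Set.Icc a b) {N : ℕ} (hN : N ≠ 0) :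
    |bernsteinPoly f a b N x - f x| ≤ C * (b - a) / (2 * √N) := by
  have hba : 0 < b - a := sub_pos.2 hab
  let t : unitInterval := ⟨(x - a) / (b - a),
    div_nonneg (sub_nonneg.2 hx.1) hba.le, (div_le_one hba).2 (sub_le_sub_right hx.2 a)⟩
  have ht : x = a + (b - a) * (t : ℝ) := by
    change x = a + (b - a) * ((x - a) / (b - a))
    rw [mul_div_cancel₀ _ hba.ne', add_sub_cancel]
  have hsum : bernsteinPoly f a b N x - f x =
      ∑ k : Fin (N + 1), (f (a + (b - a) * bernstein.z k) - f x) * bernstein N k t := by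
    simp only [sub_mul, Finset.sum_sub_distrib, ← Finset.mul_sum, bernstein.probability, mul_one]
    rw [bernsteinPoly, Finset.sum_range]
    congr 1
    refine Finset.sum_congr rfl fun k _ => ?_
    rw [bernstein_apply, show (x - a) / (b - a) = t from rfl,
      show (k : ℝ) * (b - a) / N = (b - a) * bernstein.z k by
        change _ = (b - a) * ((k : ℝ) / N)
        ring]
    ring_nf
  have hterm : ∀ k : Fin (N + 1), |(f (a + (b - a) * bernstein.z k) - f x) * bernstein N k t| ≤
      C * (b - a) * (|(t : ℝ) - bernstein.z k| * bernstein N k t) := by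
    intro k
    rw [abs_mul, abs_of_nonneg (bernstein_nonneg (x := t)), ← mul_assoc]
    refine mul_le_mul_of_nonneg_right ?_ bernstein_nonneg
    have h := hf.dist_le_mul (a + (b - a) * bernstein.z k) x
    rw [Real.dist_eq, Real.dist_eq] at h
    refine h.trans_eq ?_
    rw [ht, show a + (b - a) * (bernstein.z k : ℝ) - (a + (b - a) * (t : ℝ)) =
      (b - a) * (bernstein.z k - t) by ring, abs_mul, abs_of_pos hba, abs_sub_comm, mul_assoc]
  calc |bernsteinPoly f a b N x - f x|
      ≤ ∑ k : Fin (N + 1), C * (b - a) * (|(t : ℝ) - bernstein.z k| * bernstein N k t) := by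
        rw [hsum]
        exact (Finset.abs_sum_le_sum_abs _ _).trans (Finset.sum_le_sum fun k _ => hterm k)
    _ ≤ C * (b - a) * (1 / (2 * √N)) := by
        rw [← Finset.mul_sum]
        exact mul_le_mul_of_nonneg_left (sum_abs_sub_mul_bernstein_le hN t) (by positivity)
    _ = C * (b - a) / (2 * √N) := by ring

theorem abs_margin_le {m : ℕ} (w : EuclideanSpace ℝ (Fin m)) {v : Fin (m + 1) → ℝ}
    (hv : ∀ j, |v j| ≤ 1) : |margin w v| ≤ ‖w‖ * √m := by
  have hinner : |∑ j : Fin m, w j * v j.castSucc| ≤ ‖w‖ * √m := by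
    refine abs_le_of_sq_le_sq ?_ (by positivity)
    rw [mul_pow, Real.sq_sqrt (Nat.cast_nonneg m), EuclideanSpace.real_norm_sq_eq]
    refine (Finset.sum_mul_sq_le_sq_mul_sq _ _ _).trans ?_
    refine mul_le_mul_of_nonneg_left ?_ (Finset.sum_nonneg fun _ _ => sq_nonneg _)
    calc ∑ j : Fin m, v j.castSucc ^ 2 ≤ ∑ _j : Fin m, (1 : ℝ) :=
          Finset.sum_le_sum fun j _ => (sq_le_one_iff_abs_le_one _).2 (hv _)
      _ = m := by simp
  rw [margin, abs_mul]
  exact (mul_le_of_le_one_right (abs_nonneg _) (hv _)).trans hinner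

/-- uniform error of the Bernstein-approximated empirical risk. -/
theorem bernstein_approx_risk
    (m n d : ℕ) (hm : 1 ≤ m) (hn : 1 ≤ n) (hd : 2 ≤ d)
    (K τ : ℝ) (hK : 0 < K) (hτ : 0 < τ) (hb : 1 ≤ τ * Real.sqrt m)
    (φ : ℝ → ℝ) (hφc : Continuous φ) (hφl : LipschitzWith (Real.toNNReal K) φ)
    (Ω : Fin (m+1) → Finset ℝ) (hΩ : ValidDomains m Ω)
    (D : Fin n → Fin (m+1) → ℝ) (hD : ValidDataset Ω D)
    (w : EuclideanSpace ℝ (Fin m)) (hw : ‖w‖ ≤ τ) :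
    (∀ i : Fin n, |margin w (D i)| ≤ τ * Real.sqrt m) ∧
    |(1 / (n : ℝ)) * ∑ i : Fin n,
        bernsteinPoly φ (-(τ * Real.sqrt m)) (τ * Real.sqrt m) (d - 1) (margin w (D i)) -
      risk φ w D| ≤
      (5 / 2) * K * τ * Real.sqrt (m : ℝ) / Real.sqrt ((d : ℝ) - 1) := by
  have hmargin : ∀ i : Fin n, |margin w (D i)| ≤ τ * √m := fun i =>
    (abs_margin_le w fun j => abs_le.2 (hΩ.1 j (hD i j))).trans
      (mul_le_mul_of_nonneg_right hw (Real.sqrt_nonneg _))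
  refine ⟨hmargin, ?_⟩
  set b := τ * √m
  have hn' : (0 : ℝ) < n := by exact_mod_cast hn
  have hd' : ((d - 1 : ℕ) : ℝ) = (d : ℝ) - 1 := by push_cast [show 1 ≤ d by omega]; rfl
  have hpoint : ∀ i : Fin n,
      |bernsteinPoly φ (-b) b (d - 1) (margin w (D i)) - φ (margin w (D i))| ≤
        K * b / √((d : ℝ) - 1) := by
    intro i
    have h := abs_bernsteinPoly_sub_le hφl (show -b < b by linarith)
      (abs_le.1 (hmargin i)) (show d - 1 ≠ 0 by omega)
    rw [hd', Real.coe_toNNReal K hK.le] at h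
    refine h.trans_eq ?_
    rw [show K * (b - -b) = 2 * (K * b) by ring, mul_div_mul_left _ _ two_ne_zero]
  rw [risk, ← mul_sub, ← Finset.sum_sub_distrib, abs_mul, abs_of_pos (by positivity)]
  calc 1 / (n : ℝ) *
        |∑ i, (bernsteinPoly φ (-b) b (d - 1) (margin w (D i)) - φ (margin w (D i)))|
      ≤ 1 / (n : ℝ) * ∑ _i : Fin n, K * b / √((d : ℝ) - 1) := by
        gcongr
        exact (Finset.abs_sum_le_sum_abs _ _).trans (Finset.sum_le_sum fun i _ => hpoint i)
    _ = K * b / √((d : ℝ) - 1) := by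
        rw [Finset.sum_const, Finset.card_univ, Fintype.card_fin, nsmul_eq_mul]
        field_simp
    _ ≤ (5 / 2) * K * τ * √(m : ℝ) / √((d : ℝ) - 1) := by
        refine div_le_div_of_nonneg_right ?_ (Real.sqrt_nonneg _)
        rw [show (5 / 2) * K * τ * √(m : ℝ) = 5 / 2 * (K * b) by ring]
        linarith [mul_pos hK (show 0 < b by linarith)]
end
end
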